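/- arXiv:1506.05918 — 2 statements merged into one kernel-verified Lean document; each statement's English description precedes it below -/
import Mathlib

section
/- (Rank lemma.) Let Assumption A hold. For β ∈ ℝ define the vector field X5^β(z) = −β(M2 + M1 cos α)·[X3,[X3,X4]](z) + (κα − β M2)·[X4,[X3,X4]](z), where z = (x,y,θ,α). Then for every ε > 0 there exist β with 0 < β < ε and ᾱ > 0 such that for every z = (x,y,θ,α) ∈ ℝ⁴ with 0 < |α| < ᾱ, the four vectors X3(z), X4(z), [X3,X4](z), X5^β(z) span ℝ⁴. -/
open Real Matrix Set

/-- The 4×4 matrix E(α) of the two-link magneto-elastic swimmer,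
with blocks E11, E12, E21, E22 as in the paper. -/
noncomputable def Emat (l1 l2 x1 x2 e1 e2 a : ℝ) : Matrix (Fin 4) (Fin 4) ℝ :=
  !![ -(x1*l1 + x2*l2) * Real.cos a, -(x1*l1 + e2*l2) * Real.sin a,
        (1/2)*x1*l1*l2*Real.sin a, 0;
      (e1*l1 + x2*l2) * Real.sin a, -(e1*l1 + e2*l2) * Real.cos a,
        (1/2)*e1*l1*(l1 + l2*Real.cos a), (1/2)*e1*l1^2;
      (1/2)*(e1*l1^2*(-Real.sin a)), (1/2)*(e1*l1^2*Real.cos a - e2*l2^2),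
        -(e1*l1^2*((1/4)*l2*Real.cos a + (1/3)*l1) + e2*l2^2*((1/12)*l2)),
        -(e1*l1^2*((1/3)*l1));
      0, (1/2)*(-(e2*l2^2)), -(e2*l2^2*((1/12)*l2)), 0]

/-- R̃(θ) = diag(R_θ, I₂). -/
noncomputable def Rtil (th : ℝ) : Matrix (Fin 4) (Fin 4) ℝ :=
  !![Real.cos th, -Real.sin th, 0, 0;
     Real.sin th,  Real.cos th, 0, 0;
     0, 0, 1, 0;
     0, 0, 0, 1]

/-- X3(z) = R̃(θ)·(third column of E(α)⁻¹), where z = (x,y,θ,α). -/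
noncomputable def X3 (l1 l2 x1 x2 e1 e2 : ℝ) (z : Fin 4 → ℝ) : Fin 4 → ℝ :=
  (Rtil (z 2)).mulVec fun i => (Emat l1 l2 x1 x2 e1 e2 (z 3))⁻¹ i 2

/-- X4(z) = R̃(θ)·(fourth column of E(α)⁻¹), where z = (x,y,θ,α). -/
noncomputable def X4 (l1 l2 x1 x2 e1 e2 : ℝ) (z : Fin 4 → ℝ) : Fin 4 → ℝ :=
  (Rtil (z 2)).mulVec fun i => (Emat l1 l2 x1 x2 e1 e2 (z 3))⁻¹ i 3

/-- F0(z) = κ α X4(z). -/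
noncomputable def F0 (l1 l2 x1 x2 e1 e2 k : ℝ) (z : Fin 4 → ℝ) : Fin 4 → ℝ :=
  (k * z 3) • X4 l1 l2 x1 x2 e1 e2 z

/-- F1(z) = M1 sin α · X3(z). -/
noncomputable def F1 (l1 l2 x1 x2 e1 e2 M1 : ℝ) (z : Fin 4 → ℝ) : Fin 4 → ℝ :=
  (M1 * Real.sin (z 3)) • X3 l1 l2 x1 x2 e1 e2 z

/-- F2(z) = −(M1 cos α + M2) X3(z) − M2 X4(z). -/
noncomputable def F2 (l1 l2 x1 x2 e1 e2 M1 M2 : ℝ) (z : Fin 4 → ℝ) : Fin 4 → ℝ :=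
  (-(M1 * Real.cos (z 3) + M2)) • X3 l1 l2 x1 x2 e1 e2 z
    - M2 • X4 l1 l2 x1 x2 e1 e2 z

/-- Lie bracket of two vector fields on ℝ⁴: [X,Y](z) = DY(z)·X(z) − DX(z)·Y(z). -/
noncomputable def lieBr (X Y : (Fin 4 → ℝ) → (Fin 4 → ℝ)) (z : Fin 4 → ℝ) : Fin 4 → ℝ :=
  fderiv ℝ Y z (X z) - fderiv ℝ X z (Y z)

/-- The origin O = (0,0,0,0). -/
def Ovec : Fin 4 → ℝ := ![0, 0, 0, 0]

/-- Assumption A of the paper. -/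
def AssumptionA (l1 l2 x1 x2 e1 e2 M1 M2 : ℝ) : Prop :=
  ((e1 - x1, e2 - x2) ≠ (0, 0)) ∧ x1 ≤ e1 ∧ x2 ≤ e2 ∧ M1 ≠ 0 ∧ M2 ≠ 0 ∧
    (3 + 4*(l2/l1) + e2*l2^2/(e1*l1^2)) * M1
      - (3 + 4*(l1/l2) + e1*l1^2/(e2*l2^2)) * M2 ≠ 0

/-- The rotation-equivariant vector field on ℝ⁴ whose value at `θ = 0` is `f α`. -/
noncomputable def equivariantField (f : ℝ → Fin 4 → ℝ) (z : Fin 4 → ℝ) : Fin 4 → ℝ :=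
  (Rtil (z 2)).mulVec (f (z 3))

/-- The bracket that `lieBr` induces on the profiles of rotation-equivariant vector fields. -/
noncomputable def profileBracket (f g : ℝ → Fin 4 → ℝ) (t : ℝ) : Fin 4 → ℝ :=
  ![f t 3 * deriv (fun s => g s 0) t - g t 3 * deriv (fun s => f s 0) t
      - f t 2 * g t 1 + g t 2 * f t 1,
    f t 3 * deriv (fun s => g s 1) t - g t 3 * deriv (fun s => f s 1) t
      + f t 2 * g t 0 - g t 2 * f t 0,
    f t 3 * deriv (fun s => g s 2) t - g t 3 * deriv (fun s => f s 2) t,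
    f t 3 * deriv (fun s => g s 3) t - g t 3 * deriv (fun s => f s 3) t]

/-- The vector with horizontal part `r, s` in the frame `(u₁, u₂, 1, 0)`, `(v₁, v₂, 0, 1)` and
vertical part `x, y`. -/
def framed (u₁ u₂ v₁ v₂ x y r s : ℝ) : Fin 4 → ℝ :=
  ![x + r * u₁ + s * v₁, y + r * u₂ + s * v₂, r, s]

lemma fderiv_equivariantField {f : ℝ → Fin 4 → ℝ} {z : Fin 4 → ℝ}
    (hf : ∀ i, DifferentiableAt ℝ (fun s => f s i) (z 3)) (v : Fin 4 → ℝ) :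
    fderiv ℝ (equivariantField f) z v = (Rtil (z 2)).mulVec
      ![v 3 * deriv (fun s => f s 0) (z 3) - v 2 * f (z 3) 1,
        v 3 * deriv (fun s => f s 1) (z 3) + v 2 * f (z 3) 0,
        v 3 * deriv (fun s => f s 2) (z 3), v 3 * deriv (fun s => f s 3) (z 3)] := by
  have h2 : HasFDerivAt (fun z : Fin 4 → ℝ => z 2)
      (ContinuousLinearMap.proj (R := ℝ) (φ := fun _ : Fin 4 => ℝ) 2) z := hasFDerivAt_apply 2 z
  have h3 : HasFDerivAt (fun z : Fin 4 → ℝ => z 3)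
      (ContinuousLinearMap.proj (R := ℝ) (φ := fun _ : Fin 4 => ℝ) 3) z := hasFDerivAt_apply 3 z
  have hfi : ∀ i, HasFDerivAt (fun z : Fin 4 → ℝ => f (z 3) i)
      (deriv (fun s => f s i) (z 3) •
        ContinuousLinearMap.proj (R := ℝ) (φ := fun _ : Fin 4 => ℝ) 3) z := fun i =>
    HasDerivAt.comp_hasFDerivAt (h₂ := fun s => f s i) z (hf i).hasDerivAt h3
  have hF : equivariantField f = fun z =>
      ![Real.cos (z 2) * f (z 3) 0 - Real.sin (z 2) * f (z 3) 1,
        Real.sin (z 2) * f (z 3) 0 + Real.cos (z 2) * f (z 3) 1, f (z 3) 2, f (z 3) 3] := by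
    ext z i
    fin_cases i <;>
      simp [equivariantField, Rtil, Matrix.mulVec, dotProduct, Fin.sum_univ_four]
    ring
  have h : ∀ i, HasFDerivAt (fun z => equivariantField f z i)
      ((![(Real.cos (z 2) • (deriv (fun s => f s 0) (z 3) •
            ContinuousLinearMap.proj (R := ℝ) (φ := fun _ : Fin 4 => ℝ) 3)
          + f (z 3) 0 • (-Real.sin (z 2) • ContinuousLinearMap.proj 2))
          - (Real.sin (z 2) • (deriv (fun s => f s 1) (z 3) • ContinuousLinearMap.proj 3)
          + f (z 3) 1 • (Real.cos (z 2) • ContinuousLinearMap.proj 2)),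
        (Real.sin (z 2) • (deriv (fun s => f s 0) (z 3) • ContinuousLinearMap.proj 3)
          + f (z 3) 0 • (Real.cos (z 2) • ContinuousLinearMap.proj 2))
          + (Real.cos (z 2) • (deriv (fun s => f s 1) (z 3) • ContinuousLinearMap.proj 3)
          + f (z 3) 1 • (-Real.sin (z 2) • ContinuousLinearMap.proj 2)),
        deriv (fun s => f s 2) (z 3) • ContinuousLinearMap.proj 3,
        deriv (fun s => f s 3) (z 3) • ContinuousLinearMap.proj 3] :
          Fin 4 → ((Fin 4 → ℝ) →L[ℝ] ℝ)) i) z := by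
    rw [hF]
    intro i
    fin_cases i
    · exact (h2.cos.mul (hfi 0)).sub (h2.sin.mul (hfi 1))
    · exact (h2.sin.mul (hfi 0)).add (h2.cos.mul (hfi 1))
    · exact hfi 2
    · exact hfi 3
  rw [(hasFDerivAt_pi.2 h).fderiv]
  ext i
  fin_cases i <;>
    simp [Rtil, Matrix.mulVec, dotProduct, Fin.sum_univ_four] <;> ring

lemma lieBr_equivariantField {f g : ℝ → Fin 4 → ℝ} {z : Fin 4 → ℝ}
    (hf : ∀ i, DifferentiableAt ℝ (fun s => f s i) (z 3))
    (hg : ∀ i, DifferentiableAt ℝ (fun s => g s i) (z 3)) :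
    lieBr (equivariantField f) (equivariantField g) z
      = equivariantField (profileBracket f g) z := by
  rw [lieBr, fderiv_equivariantField hf, fderiv_equivariantField hg]
  ext i
  fin_cases i <;>
    simp [equivariantField, profileBracket, Rtil, Matrix.mulVec, dotProduct,
      Fin.sum_univ_four] <;> ring

lemma lieBr_congr_right {X Y Y' : (Fin 4 → ℝ) → Fin 4 → ℝ} {z : Fin 4 → ℝ}
    (h : Y =ᶠ[nhds z] Y') : lieBr X Y z = lieBr X Y' z := by
  rw [lieBr, lieBr, h.fderiv_eq, h.eq_of_nhds]

lemma analyticAt_profileBracket {f g : ℝ → Fin 4 → ℝ} {t : ℝ}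
    (hf : ∀ i, AnalyticAt ℝ (fun s => f s i) t) (hg : ∀ i, AnalyticAt ℝ (fun s => g s i) t)
    (i : Fin 4) : AnalyticAt ℝ (fun s => profileBracket f g s i) t := by
  have h : ∀ j, AnalyticAt ℝ (fun s => f s 3 * deriv (fun s => g s j) s
      - g s 3 * deriv (fun s => f s j) s) t := fun j =>
    ((hf 3).mul (hg j).deriv).sub ((hg 3).mul (hf j).deriv)
  fin_cases i
  · exact ((h 0).sub ((hf 2).mul (hg 1))).add ((hg 2).mul (hf 1))
  · exact ((h 1).add ((hf 2).mul (hg 0))).sub ((hg 2).mul (hf 0))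
  · exact h 2
  · exact h 3

lemma profileBracket_congr {f f' g g' : ℝ → Fin 4 → ℝ} {t : ℝ}
    (hf : f =ᶠ[nhds t] f') (hg : g =ᶠ[nhds t] g') :
    profileBracket f g t = profileBracket f' g' t := by
  have hf' : ∀ i, deriv (fun s => f s i) t = deriv (fun s => f' s i) t := fun i =>
    Filter.EventuallyEq.deriv_eq (hf.mono fun s hs => congrFun hs i)
  have hg' : ∀ i, deriv (fun s => g s i) t = deriv (fun s => g' s i) t := fun i =>
    Filter.EventuallyEq.deriv_eq (hg.mono fun s hs => congrFun hs i)
  simp only [profileBracket, hf', hg', hf.eq_of_nhds, hg.eq_of_nhds]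

lemma profileBracket_framed {u₁ u₂ v₁ v₂ a b x y r s : ℝ → ℝ} {t : ℝ}
    (hu₁ : DifferentiableAt ℝ u₁ t) (hu₂ : DifferentiableAt ℝ u₂ t)
    (hv₁ : DifferentiableAt ℝ v₁ t) (hv₂ : DifferentiableAt ℝ v₂ t)
    (ha : DifferentiableAt ℝ a t) (hb : DifferentiableAt ℝ b t)
    (hx : DifferentiableAt ℝ x t) (hy : DifferentiableAt ℝ y t)
    (hr : DifferentiableAt ℝ r t) (hs : DifferentiableAt ℝ s t) :
    profileBracket (fun t => framed (u₁ t) (u₂ t) (v₁ t) (v₂ t) 0 0 (a t) (b t))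
        (fun t => framed (u₁ t) (u₂ t) (v₁ t) (v₂ t) (x t) (y t) (r t) (s t)) t
      = framed (u₁ t) (u₂ t) (v₁ t) (v₂ t)
          (-(a t * y t) + b t * deriv x t + (a t * s t - b t * r t) * (-v₂ t - deriv u₁ t))
          (a t * x t + b t * deriv y t + (a t * s t - b t * r t) * (v₁ t - deriv u₂ t))
          (b t * deriv r t - s t * deriv a t) (b t * deriv s t - s t * deriv b t) := by
  have key : ∀ {p q x r s : ℝ → ℝ}, DifferentiableAt ℝ p t → DifferentiableAt ℝ q t →
      DifferentiableAt ℝ x t → DifferentiableAt ℝ r t → DifferentiableAt ℝ s t →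
      deriv (fun t => x t + r t * p t + s t * q t) t
        = deriv x t + (deriv r t * p t + r t * deriv p t)
          + (deriv s t * q t + s t * deriv q t) := fun hp hq hx hr hs =>
    ((hx.hasDerivAt.add (hr.hasDerivAt.mul hp.hasDerivAt)).add
      (hs.hasDerivAt.mul hq.hasDerivAt)).deriv
  have h0 : DifferentiableAt ℝ (fun _ : ℝ => (0 : ℝ)) t := differentiableAt_const 0
  have e1 := key hu₁ hv₁ hx hr hs
  have e2 := key hu₂ hv₂ hy hr hs
  have e3 := key hu₁ hv₁ h0 ha hb
  have e4 := key hu₂ hv₂ h0 ha hb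
  ext i
  fin_cases i <;> simp [profileBracket, framed] at e1 e2 e3 e4 ⊢ <;>
    simp only [e1, e2, e3, e4] <;> ring

lemma det_framed (u₁ u₂ v₁ v₂ a b c d x y r s x' y' r' s' : ℝ) :
    (Matrix.of ![framed u₁ u₂ v₁ v₂ 0 0 a b, framed u₁ u₂ v₁ v₂ 0 0 c d,
      framed u₁ u₂ v₁ v₂ x y r s, framed u₁ u₂ v₁ v₂ x' y' r' s']).det
      = (a * d - b * c) * (x * y' - y * x') := by
  simp [Matrix.det_succ_row_zero, Fin.sum_univ_succ, framed, Fin.succAbove]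
  ring

/-- If two profiles span the same plane field as the frame `(u₁, u₂, 1, 0)`, `(v₁, v₂, 0, 1)` and
the curvature of that frame does not vanish, then brackets of length three span ℝ⁴. -/
lemma det_profileBracket_ne_zero {f g : ℝ → Fin 4 → ℝ} {u₁ u₂ v₁ v₂ : ℝ → ℝ} {t : ℝ}
    (hf : ∀ i, AnalyticAt ℝ (fun s => f s i) t) (hg : ∀ i, AnalyticAt ℝ (fun s => g s i) t)
    (hu₁ : AnalyticAt ℝ u₁ t) (hu₂ : AnalyticAt ℝ u₂ t)
    (hv₁ : AnalyticAt ℝ v₁ t) (hv₂ : AnalyticAt ℝ v₂ t)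
    (hff : f =ᶠ[nhds t] fun s => framed (u₁ s) (u₂ s) (v₁ s) (v₂ s) 0 0 (f s 2) (f s 3))
    (hgf : g =ᶠ[nhds t] fun s => framed (u₁ s) (u₂ s) (v₁ s) (v₂ s) 0 0 (g s 2) (g s 3))
    (hδ : f t 2 * g t 3 - f t 3 * g t 2 ≠ 0) (hw : -v₂ t - deriv u₁ t ≠ 0) :
    (Matrix.of ![f t, g t, profileBracket f g t,
        profileBracket f (profileBracket f g) t]).det ≠ 0 ∨
      (Matrix.of ![f t, g t, profileBracket f g t,
        profileBracket g (profileBracket f g) t]).det ≠ 0 := by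
  set x : ℝ → ℝ := fun s => (f s 2 * g s 3 - f s 3 * g s 2) * (-v₂ s - deriv u₁ s) with hx
  set y : ℝ → ℝ := fun s => (f s 2 * g s 3 - f s 3 * g s 2) * (v₁ s - deriv u₂ s) with hy
  set r : ℝ → ℝ := fun s => f s 3 * deriv (fun s => g s 2) s - g s 3 * deriv (fun s => f s 2) s
    with hr
  set q : ℝ → ℝ := fun s => f s 3 * deriv (fun s => g s 3) s - g s 3 * deriv (fun s => f s 3) s
    with hq
  have hδa : AnalyticAt ℝ (fun s => f s 2 * g s 3 - f s 3 * g s 2) t :=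
    ((hf 2).mul (hg 3)).sub ((hf 3).mul (hg 2))
  have hxa : AnalyticAt ℝ x t := hδa.mul (hv₂.neg.sub hu₁.deriv)
  have hya : AnalyticAt ℝ y t := hδa.mul (hv₁.sub hu₂.deriv)
  have hra : AnalyticAt ℝ r t := ((hf 3).mul (hg 2).deriv).sub ((hg 3).mul (hf 2).deriv)
  have hqa : AnalyticAt ℝ q t := ((hf 3).mul (hg 3).deriv).sub ((hg 3).mul (hf 3).deriv)
  have hB : profileBracket f g =ᶠ[nhds t]
      fun s => framed (u₁ s) (u₂ s) (v₁ s) (v₂ s) (x s) (y s) (r s) (q s) := by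
    filter_upwards [hff.eventually_nhds, hgf.eventually_nhds, hu₁.eventually_analyticAt,
      hu₂.eventually_analyticAt, hv₁.eventually_analyticAt, hv₂.eventually_analyticAt,
      (hf 2).eventually_analyticAt, (hf 3).eventually_analyticAt,
      (hg 2).eventually_analyticAt, (hg 3).eventually_analyticAt]
      with s h1 h2 h3 h4 h5 h6 h7 h8 h9 h10
    rw [profileBracket_congr h1 h2, profileBracket_framed h3.differentiableAt h4.differentiableAt
      h5.differentiableAt h6.differentiableAt h7.differentiableAt h8.differentiableAt
      (differentiableAt_const 0) (differentiableAt_const 0)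
      h9.differentiableAt h10.differentiableAt]
    simp [hx, hy, hr, hq]
  have hBf := profileBracket_framed hu₁.differentiableAt hu₂.differentiableAt hv₁.differentiableAt
    hv₂.differentiableAt (hf 2).differentiableAt (hf 3).differentiableAt hxa.differentiableAt
    hya.differentiableAt hra.differentiableAt hqa.differentiableAt
  have hBg := profileBracket_framed hu₁.differentiableAt hu₂.differentiableAt hv₁.differentiableAt
    hv₂.differentiableAt (hg 2).differentiableAt (hg 3).differentiableAt hxa.differentiableAt
    hya.differentiableAt hra.differentiableAt hqa.differentiableAt
  rw [profileBracket_congr hff hB, profileBracket_congr hgf hB, hBf, hBg, hB.eq_of_nhds,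
    hff.eq_of_nhds, hgf.eq_of_nhds, det_framed, det_framed]
  by_contra! hPQ
  obtain ⟨hP, hQ⟩ := hPQ
  have hP' := (mul_eq_zero.1 hP).resolve_left hδ
  have hQ' := (mul_eq_zero.1 hQ).resolve_left hδ
  simp only [framed, Matrix.cons_val] at hP' hQ'
  have hsq : (f t 2 * g t 3 - f t 3 * g t 2) * (x t ^ 2 + y t ^ 2) = 0 := by
    have hxy : x t * (v₁ t - deriv u₂ t) = y t * (-v₂ t - deriv u₁ t) := by
      simp only [hx, hy]; ring
    linear_combination g t 3 * hP' - f t 3 * hQ' - (g t 3 * (f t 2 * q t - f t 3 * r t)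
      - f t 3 * (g t 2 * q t - g t 3 * r t)) * hxy
  have hx0 : x t ≠ 0 := mul_ne_zero hδ hw
  exact mul_ne_zero hδ (by positivity) hsq

lemma analyticAt_det {n : ℕ} {A : ℝ → Matrix (Fin n) (Fin n) ℝ} {t : ℝ}
    (hA : ∀ i j, AnalyticAt ℝ (fun s => A s i j) t) : AnalyticAt ℝ (fun s => (A s).det) t := by
  simp only [Matrix.det_apply]
  refine Finset.analyticAt_fun_sum _ fun σ _ => ?_
  simp only [Units.smul_def, zsmul_eq_mul]
  exact analyticAt_const.mul (Finset.analyticAt_fun_prod _ fun i _ => hA _ _)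

lemma analyticAt_inv_apply {n : ℕ} {A : ℝ → Matrix (Fin n) (Fin n) ℝ} {t : ℝ}
    (hA : ∀ i j, AnalyticAt ℝ (fun s => A s i j) t) (h : (A t).det ≠ 0) (i j : Fin n) :
    AnalyticAt ℝ (fun s => (A s)⁻¹ i j) t := by
  simp only [Matrix.inv_def, Ring.inverse_eq_inv', Matrix.smul_apply, smul_eq_mul,
    Matrix.adjugate_apply]
  refine ((analyticAt_det hA).inv h).mul (analyticAt_det fun k l => ?_)
  by_cases hk : k = j
  · subst hk
    simpa using analyticAt_const
  · simpa [Matrix.updateRow_ne hk] using hA k l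

lemma analyticAt_Emat (l1 l2 x1 x2 e1 e2 t : ℝ) (i j : Fin 4) :
    AnalyticAt ℝ (fun s => Emat l1 l2 x1 x2 e1 e2 s i j) t := by
  fin_cases i <;> fin_cases j <;> simp [Emat] <;> fun_prop

lemma det_Emat_zero (l1 l2 x1 x2 e1 e2 : ℝ) :
    (Emat l1 l2 x1 x2 e1 e2 0).det = -((x1 * l1 + x2 * l2) *
      ((e1 * l1) * (e2 * l2) * (e1 * l1 + e2 * l2) * l1 ^ 2 * l2 ^ 2 / 36)) := by
  simp [Emat, Matrix.det_succ_row_zero, Fin.sum_univ_succ, Fin.succAbove]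
  ring

/-- For analytic `P`, `Q` not both vanishing at `0`, the combination
`-β (M₂ + M₁ cos α) P + (k α - β M₂) Q` is nonzero near `0` for some arbitrarily small `β`. -/
lemma exists_eventually_combination_ne_zero {P Q : ℝ → ℝ} (hP : AnalyticAt ℝ P 0)
    (hQ : AnalyticAt ℝ Q 0) (hPQ : P 0 ≠ 0 ∨ Q 0 ≠ 0) {k M1 M2 ε : ℝ} (hk : 0 < k)
    (hM1 : M1 ≠ 0) (hε : 0 < ε) :
    ∃ β, 0 < β ∧ β < ε ∧ ∀ᶠ a in nhdsWithin (0 : ℝ) {0}ᶜ,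
      -(β * (M2 + M1 * Real.cos a)) * P a + (k * a - β * M2) * Q a ≠ 0 := by
  have han : ∀ β : ℝ, AnalyticAt ℝ
      (fun a => -(β * (M2 + M1 * Real.cos a)) * P a + (k * a - β * M2) * Q a) 0 := by
    intro β
    fun_prop
  by_contra! hcon
  have hzero : ∀ β, 0 < β → β < ε → ∀ᶠ a in nhds (0 : ℝ),
      -(β * (M2 + M1 * Real.cos a)) * P a + (k * a - β * M2) * Q a = 0 := fun β h0 h1 =>
    (han β).eventually_eq_zero_or_eventually_ne_zero.resolve_right
      (fun h => hcon β h0 h1 (by simpa using h))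
  have h1 := hzero (ε / 2) (by linarith) (by linarith)
  have h2 := hzero (ε / 3) (by linarith) (by linarith)
  have hQ0 : ∀ᶠ a in nhdsWithin (0 : ℝ) {0}ᶜ, Q a = 0 := by
    filter_upwards [nhdsWithin_le_nhds h1, nhdsWithin_le_nhds h2, self_mem_nhdsWithin]
      with a e1 e2 ha
    have : k * a * Q a = 0 := by linear_combination 3 * e2 - 2 * e1
    exact (mul_eq_zero.1 this).resolve_left (mul_ne_zero hk.ne' ha)
  have hQz : Q 0 = 0 :=
    tendsto_nhds_unique (hQ.continuousAt.tendsto.mono_left nhdsWithin_le_nhds)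
      (tendsto_const_nhds.congr' (hQ0.mono fun a ha => ha.symm))
  have hP0 : P 0 ≠ 0 := hPQ.resolve_right (by simpa using hQz)
  have hcos : ∀ᶠ a in nhdsWithin (0 : ℝ) {0}ᶜ, M2 + M1 * Real.cos a = 0 := by
    filter_upwards [nhdsWithin_le_nhds h1, hQ0,
      nhdsWithin_le_nhds (hP.continuousAt.eventually_ne hP0)] with a e1 e2 e3
    rw [e2] at e1
    have : ε / 2 * P a * (M2 + M1 * Real.cos a) = 0 := by linear_combination -e1
    exact (mul_eq_zero.1 this).resolve_left (mul_ne_zero (by positivity) e3)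
  have hcos' : (fun a => M2 + M1 * Real.cos a) =ᶠ[nhds 0] fun _ => 0 := by
    have ha : AnalyticAt ℝ (fun a => M2 + M1 * Real.cos a) 0 := by fun_prop
    exact (ha.frequently_eq_iff_eventually_eq analyticAt_const).1 hcos.frequently
  have hd : (deriv fun a => M2 + M1 * Real.cos a) =ᶠ[nhds 0] deriv fun _ => 0 := hcos'.deriv
  have hdd := hd.deriv_eq
  simp [hM1] at hdd

lemma span_mulVec_eq_top {R : Matrix (Fin 4) (Fin 4) ℝ} (hR : IsUnit R.det)
    {a b c d : Fin 4 → ℝ} (h : (Matrix.of ![a, b, c, d]).det ≠ 0) :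
    Submodule.span ℝ ({R.mulVec a, R.mulVec b, R.mulVec c, R.mulVec d} : Set (Fin 4 → ℝ)) = ⊤ := by
  have hrow : Matrix.of ![a, b, c, d] * Rᵀ
      = Matrix.of ![R.mulVec a, R.mulVec b, R.mulVec c, R.mulVec d] := by
    ext i j
    fin_cases i <;> simp [Matrix.mul_apply, Matrix.mulVec, dotProduct, mul_comm]
  have hdet : IsUnit (Matrix.of ![R.mulVec a, R.mulVec b, R.mulVec c, R.mulVec d]) := by
    rw [Matrix.isUnit_iff_isUnit_det, ← hrow, Matrix.det_mul, Matrix.det_transpose]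
    exact (isUnit_iff_ne_zero.2 h).mul hR
  have hli := Matrix.linearIndependent_rows_iff_isUnit.2 hdet
  have hspan := hli.span_eq_top_of_card_eq_finrank' (by simp)
  rw [← hspan]
  congr 1
  ext v
  simp only [Set.mem_insert_iff, Set.mem_singleton_iff]
  constructor
  · rintro (rfl | rfl | rfl | rfl)
    exacts [⟨0, rfl⟩, ⟨1, rfl⟩, ⟨2, rfl⟩, ⟨3, rfl⟩]
  · rintro ⟨i, rfl⟩
    fin_cases i <;> simp

lemma isUnit_det_Rtil (th : ℝ) : IsUnit (Rtil th).det := by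
  have : (Rtil th).det = 1 := by
    simp [Rtil, Matrix.det_succ_row_zero, Fin.sum_univ_succ, Fin.succAbove]
    linear_combination Real.cos_sq_add_sin_sq th
  simp [this]

/-- The profiles of `X3` and `X4` satisfy the hypotheses of `det_profileBracket_ne_zero`. -/
lemma det_profileBracket_inv_Emat_ne_zero {l1 l2 x1 x2 e1 e2 : ℝ} (hl1 : 0 < l1) (hl2 : 0 < l2)
    (hx1 : 0 < x1) (hx2 : 0 < x2) (he1 : 0 < e1) (he2 : 0 < e2)
    (hne : (e1 - x1, e2 - x2) ≠ (0, 0)) (h1 : x1 ≤ e1) (h2 : x2 ≤ e2) {f g : ℝ → Fin 4 → ℝ}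
    (hfE : f = fun s i => (Emat l1 l2 x1 x2 e1 e2 s)⁻¹ i 2)
    (hgE : g = fun s i => (Emat l1 l2 x1 x2 e1 e2 s)⁻¹ i 3)
    (hf : ∀ i, AnalyticAt ℝ (fun s => f s i) 0) (hg : ∀ i, AnalyticAt ℝ (fun s => g s i) 0)
    (hdet : (Emat l1 l2 x1 x2 e1 e2 0).det ≠ 0) :
    (Matrix.of ![f 0, g 0, profileBracket f g 0,
        profileBracket f (profileBracket f g) 0]).det ≠ 0 ∨
      (Matrix.of ![f 0, g 0, profileBracket f g 0,
        profileBracket g (profileBracket f g) 0]).det ≠ 0 := by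
  have hΔ : 0 < (x1 * l1 + x2 * l2) * (e1 * l1 + e2 * l2) := by positivity
  have hΔs : ∀ s : ℝ, 0 < (x1 * l1 + x2 * l2) * (e1 * l1 + e2 * l2) * Real.cos s ^ 2
      + (x1 * l1 + e2 * l2) * (e1 * l1 + x2 * l2) * Real.sin s ^ 2 := by
    intro s
    have hΔ' : 0 < (x1 * l1 + e2 * l2) * (e1 * l1 + x2 * l2) := by positivity
    rcases eq_or_ne (Real.cos s) 0 with hc | hc
    · have : Real.sin s ≠ 0 := fun hs => by
        have := Real.cos_sq_add_sin_sq s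
        simp [hc, hs] at this
      positivity
    · positivity
  have hΔa : ∀ s : ℝ, (x1 * l1 + x2 * l2) * (e1 * l1 + e2 * l2) * Real.cos s ^ 2
      + (x1 * l1 + e2 * l2) * (e1 * l1 + x2 * l2) * Real.sin s ^ 2 ≠ 0 := fun s => (hΔs s).ne'
  set Δ : ℝ → ℝ := fun s => (x1 * l1 + x2 * l2) * (e1 * l1 + e2 * l2) * Real.cos s ^ 2
      + (x1 * l1 + e2 * l2) * (e1 * l1 + x2 * l2) * Real.sin s ^ 2 with hΔd
  set u₁ : ℝ → ℝ := fun s => ((e1 * l1 + e2 * l2) * Real.cos s * (1 / 2 * x1 * l1 * l2 * Real.sin s)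
      - (x1 * l1 + e2 * l2) * Real.sin s * (1 / 2 * e1 * l1 * (l1 + l2 * Real.cos s))) / Δ s with hu₁
  set u₂ : ℝ → ℝ := fun s => ((e1 * l1 + x2 * l2) * Real.sin s * (1 / 2 * x1 * l1 * l2 * Real.sin s)
      + (x1 * l1 + x2 * l2) * Real.cos s * (1 / 2 * e1 * l1 * (l1 + l2 * Real.cos s))) / Δ s with hu₂
  set v₁ : ℝ → ℝ := fun s =>
      (-((x1 * l1 + e2 * l2) * Real.sin s * (1 / 2 * e1 * l1 ^ 2))) / Δ s with hv₁
  set v₂ : ℝ → ℝ := fun s =>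
      ((x1 * l1 + x2 * l2) * Real.cos s * (1 / 2 * e1 * l1 ^ 2)) / Δ s with hv₂
  have hΔan : AnalyticAt ℝ Δ 0 := by fun_prop
  have hu₁a : AnalyticAt ℝ u₁ 0 := AnalyticAt.div (by fun_prop) hΔan (hΔa 0)
  have hu₂a : AnalyticAt ℝ u₂ 0 := AnalyticAt.div (by fun_prop) hΔan (hΔa 0)
  have hv₁a : AnalyticAt ℝ v₁ 0 := AnalyticAt.div (by fun_prop) hΔan (hΔa 0)
  have hv₂a : AnalyticAt ℝ v₂ 0 := AnalyticAt.div (by fun_prop) hΔan (hΔa 0)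
  have hframe : ∀ {s : ℝ} {w : Fin 4 → ℝ}, (Emat l1 l2 x1 x2 e1 e2 s).mulVec w 0 = 0 →
      (Emat l1 l2 x1 x2 e1 e2 s).mulVec w 1 = 0 →
      w = framed (u₁ s) (u₂ s) (v₁ s) (v₂ s) 0 0 (w 2) (w 3) := by
    intro s w h0 h1
    simp [Emat, Matrix.mulVec, dotProduct, Fin.sum_univ_four] at h0 h1
    have hs : Δ s ≠ 0 := hΔa s
    ext i
    fin_cases i <;> simp [framed, hu₁, hu₂, hv₁, hv₂]
    · field_simp
      simp only [hΔd]
      linear_combination (-2 * (e1 * l1 + e2 * l2) * Real.cos s) * h0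
        + (2 * (x1 * l1 + e2 * l2) * Real.sin s) * h1
    · field_simp
      simp only [hΔd]
      linear_combination (-2 * (e1 * l1 + x2 * l2) * Real.sin s) * h0
        - (2 * (x1 * l1 + x2 * l2) * Real.cos s) * h1
  have hcol : ∀ {s : ℝ}, (Emat l1 l2 x1 x2 e1 e2 s).det ≠ 0 → ∀ i j,
      (Emat l1 l2 x1 x2 e1 e2 s).mulVec (fun k => (Emat l1 l2 x1 x2 e1 e2 s)⁻¹ k j) i
        = (1 : Matrix (Fin 4) (Fin 4) ℝ) i j := by
    intro s hs i j
    rw [← Matrix.mul_nonsing_inv _ (isUnit_iff_ne_zero.2 hs)]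
    rfl
  have hff : ∀ {s : ℝ}, (Emat l1 l2 x1 x2 e1 e2 s).det ≠ 0 →
      f s = framed (u₁ s) (u₂ s) (v₁ s) (v₂ s) 0 0 (f s 2) (f s 3) := by
    intro s hs
    subst hfE
    exact hframe (by rw [hcol hs]; simp) (by rw [hcol hs]; simp)
  have hgf : ∀ {s : ℝ}, (Emat l1 l2 x1 x2 e1 e2 s).det ≠ 0 →
      g s = framed (u₁ s) (u₂ s) (v₁ s) (v₂ s) 0 0 (g s 2) (g s 3) := by
    intro s hs
    subst hgE
    exact hframe (by rw [hcol hs]; simp) (by rw [hcol hs]; simp)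
  have hdets : ∀ᶠ s in nhds 0, (Emat l1 l2 x1 x2 e1 e2 s).det ≠ 0 :=
    (analyticAt_det (analyticAt_Emat l1 l2 x1 x2 e1 e2 0)).continuousAt.eventually_ne hdet
  refine det_profileBracket_ne_zero hf hg hu₁a hu₂a hv₁a hv₂a (hdets.mono fun s => hff)
    (hdets.mono fun s => hgf) ?_ ?_
  · intro hδ
    have hlow : ∀ i : Fin 4, ∀ r s : ℝ, (Emat l1 l2 x1 x2 e1 e2 0).mulVec
        (framed (u₁ 0) (u₂ 0) (v₁ 0) (v₂ 0) 0 0 r s) i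
        = r * (Emat l1 l2 x1 x2 e1 e2 0).mulVec (framed (u₁ 0) (u₂ 0) (v₁ 0) (v₂ 0) 0 0 1 0) i
        + s * (Emat l1 l2 x1 x2 e1 e2 0).mulVec (framed (u₁ 0) (u₂ 0) (v₁ 0) (v₂ 0) 0 0 0 1) i := by
      intro i r s
      simp only [Matrix.mulVec, dotProduct, Fin.sum_univ_four, framed, Matrix.cons_val]
      ring
    have hfc := fun i => hcol hdet i 2
    have hgc := fun i => hcol hdet i 3
    rw [← congrFun hfE 0, hff hdet] at hfc
    rw [← congrFun hgE 0, hgf hdet] at hgc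
    have hf2 := (hlow 2 _ _).symm.trans (hfc 2)
    have hf3 := (hlow 3 _ _).symm.trans (hfc 3)
    have hg2 := (hlow 2 _ _).symm.trans (hgc 2)
    have hg3 := (hlow 3 _ _).symm.trans (hgc 3)
    rw [Matrix.one_apply_eq] at hf2 hg3
    rw [Matrix.one_apply_ne (by decide)] at hf3 hg2
    generalize (Emat l1 l2 x1 x2 e1 e2 0).mulVec
      (framed (u₁ 0) (u₂ 0) (v₁ 0) (v₂ 0) 0 0 1 0) = S at hf2 hf3 hg2 hg3
    generalize (Emat l1 l2 x1 x2 e1 e2 0).mulVec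
      (framed (u₁ 0) (u₂ 0) (v₁ 0) (v₂ 0) 0 0 0 1) = T at hf2 hf3 hg2 hg3
    refine one_ne_zero (α := ℝ) ?_
    linear_combination (S 2 * T 3 - S 3 * T 2) * hδ - (g 0 2 * S 3 + g 0 3 * T 3) * hf2 - hg3
      + (g 0 2 * S 2 + g 0 3 * T 2) * hf3
  · have hd : deriv u₁ 0 = ((e1 * l1 + e2 * l2) * (1 / 2 * x1 * l1 * l2)
        - (x1 * l1 + e2 * l2) * (1 / 2 * e1 * l1 * (l1 + l2))) / Δ 0 := by
      have hG : AnalyticAt ℝ (fun s => ((e1 * l1 + e2 * l2) * Real.cos s * (1 / 2 * x1 * l1 * l2)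
          - (x1 * l1 + e2 * l2) * (1 / 2 * e1 * l1 * (l1 + l2 * Real.cos s))) / Δ s) 0 :=
        AnalyticAt.div (by fun_prop) hΔan (hΔa 0)
      have hsin := (Real.hasDerivAt_sin 0).mul hG.differentiableAt.hasDerivAt
      have hu : u₁ = Real.sin * fun s => ((e1 * l1 + e2 * l2) * Real.cos s * (1 / 2 * x1 * l1 * l2)
          - (x1 * l1 + e2 * l2) * (1 / 2 * e1 * l1 * (l1 + l2 * Real.cos s))) / Δ s := by
        ext s
        simp only [hu₁, Pi.mul_apply]
        ring
      rw [hu, hsin.deriv]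
      simp
    have hΔ0 : Δ 0 = (x1 * l1 + x2 * l2) * (e1 * l1 + e2 * l2) := by simp [hΔd]
    have hval : -v₂ 0 - deriv u₁ 0 = l1 * l2 / 2 * (e1 * l1 * (e2 - x2) + e2 * l2 * (e1 - x1))
        / Δ 0 := by
      rw [hd]
      simp [hv₂]
      ring
    rw [hval, hΔ0]
    have hpos : 0 < e1 * l1 * (e2 - x2) + e2 * l2 * (e1 - x1) := by
      rcases h1.lt_or_eq with h | h
      · have := sub_pos.2 h
        have := sub_nonneg.2 h2
        positivity
      · have h' : x2 < e2 := h2.lt_of_ne fun h' => hne (by simp [h, h'])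
        have := sub_pos.2 h'
        have := sub_nonneg.2 h1
        positivity
    positivity

/-- Rank lemma, Lemma 3 of the paper. -/
theorem stmt_15 (l1 l2 x1 x2 e1 e2 k M1 M2 : ℝ)
    (hl1 : 0 < l1) (hl2 : 0 < l2) (hx1 : 0 < x1) (hx2 : 0 < x2)
    (he1 : 0 < e1) (he2 : 0 < e2) (hk : 0 < k)
    (hA : AssumptionA l1 l2 x1 x2 e1 e2 M1 M2) :
    ∀ ε : ℝ, 0 < ε → ∃ β : ℝ, 0 < β ∧ β < ε ∧ ∃ ab : ℝ, 0 < ab ∧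
      ∀ z : Fin 4 → ℝ, 0 < |z 3| → |z 3| < ab →
        Submodule.span ℝ
          ({X3 l1 l2 x1 x2 e1 e2 z,
            X4 l1 l2 x1 x2 e1 e2 z,
            lieBr (X3 l1 l2 x1 x2 e1 e2) (X4 l1 l2 x1 x2 e1 e2) z,
            (-(β * (M2 + M1 * Real.cos (z 3)))) •
              lieBr (X3 l1 l2 x1 x2 e1 e2)
                (lieBr (X3 l1 l2 x1 x2 e1 e2) (X4 l1 l2 x1 x2 e1 e2)) z
            + (k * z 3 - β * M2) •
              lieBr (X4 l1 l2 x1 x2 e1 e2)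
                (lieBr (X3 l1 l2 x1 x2 e1 e2) (X4 l1 l2 x1 x2 e1 e2)) z} :
            Set (Fin 4 → ℝ)) = ⊤ := by
  obtain ⟨hne, h1, h2, hM1, -, -⟩ := hA
  intro ε hε
  have hdet : (Emat l1 l2 x1 x2 e1 e2 0).det ≠ 0 := by
    rw [det_Emat_zero]
    exact neg_ne_zero.2 (by positivity)
  set f : ℝ → Fin 4 → ℝ := fun s i => (Emat l1 l2 x1 x2 e1 e2 s)⁻¹ i 2 with hfE
  set g : ℝ → Fin 4 → ℝ := fun s i => (Emat l1 l2 x1 x2 e1 e2 s)⁻¹ i 3 with hgE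
  have hX3 : X3 l1 l2 x1 x2 e1 e2 = equivariantField f := rfl
  have hX4 : X4 l1 l2 x1 x2 e1 e2 = equivariantField g := rfl
  have hf : ∀ i, AnalyticAt ℝ (fun s => f s i) 0 := fun i =>
    analyticAt_inv_apply (analyticAt_Emat l1 l2 x1 x2 e1 e2 0) hdet i 2
  have hg : ∀ i, AnalyticAt ℝ (fun s => g s i) 0 := fun i =>
    analyticAt_inv_apply (analyticAt_Emat l1 l2 x1 x2 e1 e2 0) hdet i 3
  have hb := fun i => analyticAt_profileBracket hf hg i
  have hdetan : ∀ {h : ℝ → Fin 4 → ℝ}, (∀ i, AnalyticAt ℝ (fun s => h s i) 0) →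
      AnalyticAt ℝ (fun s => (Matrix.of ![f s, g s, profileBracket f g s, h s]).det) 0 := by
    intro h hh
    refine analyticAt_det fun i j => ?_
    fin_cases i
    exacts [hf j, hg j, hb j, hh j]
  obtain ⟨β, hβ0, hβ1, hβ⟩ := exists_eventually_combination_ne_zero (M2 := M2)
    (hdetan fun i => analyticAt_profileBracket hf hb i)
    (hdetan fun i => analyticAt_profileBracket hg hb i)
    (det_profileBracket_inv_Emat_ne_zero hl1 hl2 hx1 hx2 he1 he2 hne h1 h2 hfE hgE hf hg hdet)
    hk hM1 hε
  have hfgan : ∀ᶠ s in nhds (0 : ℝ), ∀ i, AnalyticAt ℝ (fun s => f s i) s ∧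
      AnalyticAt ℝ (fun s => g s i) s := Filter.eventually_all.2 fun i =>
    (hf i).eventually_analyticAt.and (hg i).eventually_analyticAt
  obtain ⟨ab, hab, hball⟩ := Metric.eventually_nhds_iff.1
    ((eventually_nhdsWithin_iff.1 hβ).and hfgan.eventually_nhds)
  refine ⟨β, hβ0, hβ1, ab, hab, fun z hz0 hz1 => ?_⟩
  obtain ⟨hD, han⟩ := hball (y := z 3) (by simpa using hz1)
  have hD := hD (by simpa using hz0)
  have hdf := fun i => (han.self_of_nhds i).1.differentiableAt
  have hdg := fun i => (han.self_of_nhds i).2.differentiableAt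
  have hdb := fun i => (analyticAt_profileBracket (fun i => (han.self_of_nhds i).1)
    (fun i => (han.self_of_nhds i).2) i).differentiableAt
  have hbr : lieBr (equivariantField f) (equivariantField g) =ᶠ[nhds z]
      equivariantField (profileBracket f g) :=
    ((continuous_apply (3 : Fin 4)).continuousAt.eventually han).mono fun w hw =>
      lieBr_equivariantField (fun i => (hw i).1.differentiableAt)
        (fun i => (hw i).2.differentiableAt)
  rw [hX3, hX4, lieBr_congr_right hbr, lieBr_congr_right hbr, hbr.eq_of_nhds,
    lieBr_equivariantField hdf hdb, lieBr_equivariantField hdg hdb]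
  simp only [equivariantField, ← Matrix.mulVec_smul, ← Matrix.mulVec_add]
  refine span_mulVec_eq_top (isUnit_det_Rtil _) ?_
  convert hD using 1
  simp [Matrix.det_succ_row_zero, Fin.sum_univ_succ, Fin.succAbove]
  ring
end

section
/- (Characterization of equilibria.) Suppose ℓ1, ℓ2, ξ1, ξ2, η1, η2, κ > 0. Then for every z = (x, y, θ, α) ∈ ℝ⁴, the vector X4(z) is nonzero, and consequently F0(z) = 0 if and only if α = 0. In other words, the equilibrium positions of the uncontrolled dynamics ż = F0(z) are exactly the points (x, y, θ, 0) with (x, y, θ) arbitrary. -/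
open Real Matrix Set

theorem det_Emat (l1 l2 x1 x2 e1 e2 a : ℝ) :
    (Emat l1 l2 x1 x2 e1 e2 a).det =
      -(e1 * e2 * l1 ^ 3 * l2 ^ 3 / 144 *
        (4 * (x1 * l1 + x2 * l2) * (e1 * l1 + e2 * l2) * Real.cos a ^ 2 +
          (4 * (x1 * l1) + e2 * l2) * (e1 * l1 + 4 * (x2 * l2)) * Real.sin a ^ 2)) := by
  simp [Emat, Matrix.det_succ_row_zero, Fin.sum_univ_succ, Fin.succAbove]
  ring

theorem det_Emat_neg {l1 l2 x1 x2 e1 e2 : ℝ} (hl1 : 0 < l1) (hl2 : 0 < l2) (hx1 : 0 < x1)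
    (hx2 : 0 < x2) (he1 : 0 < e1) (he2 : 0 < e2) (a : ℝ) :
    (Emat l1 l2 x1 x2 e1 e2 a).det < 0 := by
  rw [det_Emat, neg_lt_zero]
  refine mul_pos (by positivity) ?_
  rcases eq_or_ne (Real.cos a) 0 with hc | hc
  · have hs : Real.sin a ^ 2 = 1 := by simpa [hc] using Real.sin_sq_add_cos_sq a
    rw [hs]
    positivity
  · positivity

theorem det_Rtil (th : ℝ) : (Rtil th).det = 1 := by
  simp [Rtil, Matrix.det_succ_row_zero, Fin.sum_univ_succ, Fin.succAbove]
  linarith [Real.sin_sq_add_cos_sq th]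

theorem X4_ne_zero {l1 l2 x1 x2 e1 e2 : ℝ} (hl1 : 0 < l1) (hl2 : 0 < l2) (hx1 : 0 < x1)
    (hx2 : 0 < x2) (he1 : 0 < e1) (he2 : 0 < e2) (z : Fin 4 → ℝ) :
    X4 l1 l2 x1 x2 e1 e2 z ≠ 0 := by
  intro h
  have hcol := Matrix.eq_zero_of_mulVec_eq_zero (by simp [det_Rtil]) h
  have hmul := Matrix.mul_nonsing_inv (Emat l1 l2 x1 x2 e1 e2 (z 3))
    (det_Emat_neg hl1 hl2 hx1 hx2 he1 he2 (z 3)).ne.isUnit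
  have hentry := congrFun (congrFun hmul 3) 3
  rw [Matrix.mul_apply] at hentry
  simp [fun j => congrFun hcol j] at hentry

/-- Characterization of equilibria: X4 never vanishes, and
F0(z) = 0 iff α = 0. -/
theorem stmt_18 (l1 l2 x1 x2 e1 e2 k M1 M2 : ℝ)
    (hl1 : 0 < l1) (hl2 : 0 < l2) (hx1 : 0 < x1) (hx2 : 0 < x2)
    (he1 : 0 < e1) (he2 : 0 < e2) (hk : 0 < k) :
    ∀ z : Fin 4 → ℝ,
      X4 l1 l2 x1 x2 e1 e2 z ≠ 0 ∧
      (F0 l1 l2 x1 x2 e1 e2 k z = 0 ↔ z 3 = 0) := by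
  intro z
  have hX4 := X4_ne_zero hl1 hl2 hx1 hx2 he1 he2 z
  exact ⟨hX4, by simp [F0, hX4, hk.ne']⟩
end
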